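/- arXiv:2411.05441 — 5 statements merged into one kernel-verified Lean document; each statement's English description precedes it below -/
import Mathlib

section
/- The boundary value problem (BVP) admits exactly one solution u = (u₁,…,u_N), and it is given explicitly by u_i(x) = −κ_i α_i(x)/α_i(0) − β_i(x) for all x ∈ [0,δ] and all 1 ≤ i ≤ N. -/
open Set

noncomputable section

/-- `α(x) = ∫_x^δ exp(−∫_0^y 2b(z)/σ(z)² dz) dy`. -/
def bvpAlpha (δ : ℝ) (σ b : ℝ → ℝ) (x : ℝ) : ℝ :=
  ∫ y in x..δ, Real.exp (-(∫ z in (0:ℝ)..y, 2 * b z / (σ z)^2))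

/-- `β(x) = ∫_x^δ (∫_0^y (2f(z)/σ(z)²) exp(∫_0^z 2b(s)/σ(s)² ds) dz)
      exp(−∫_0^y 2b(z)/σ(z)² dz) dy`. -/
def bvpBeta (δ : ℝ) (σ b f : ℝ → ℝ) (x : ℝ) : ℝ :=
  ∫ y in x..δ,
    (∫ z in (0:ℝ)..y,
        (2 * f z / (σ z)^2) * Real.exp (∫ s in (0:ℝ)..z, 2 * b s / (σ s)^2)) *
      Real.exp (-(∫ z in (0:ℝ)..y, 2 * b z / (σ z)^2))

/-- The constant `κ_i` appearing in the explicit solution of the boundary value problem. -/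
def bvpKappa (N : ℕ) (hN : 0 < N) (δ η fv : ℝ) (ρ : Fin N → ℝ)
    (σ b f : Fin N → ℝ → ℝ) (i : Fin N) : ℝ :=
  (η * fv -
      ∑ j, ρ j * (bvpBeta δ (σ ⟨0, hN⟩) (b ⟨0, hN⟩) (f ⟨0, hN⟩) 0
          - bvpBeta δ (σ j) (b j) (f j) 0) / bvpAlpha δ (σ j) (b j) 0) *
    (∑ j, ρ j / bvpAlpha δ (σ j) (b j) 0)⁻¹
  + bvpBeta δ (σ ⟨0, hN⟩) (b ⟨0, hN⟩) (f ⟨0, hN⟩) 0 - bvpBeta δ (σ i) (b i) (f i) 0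

/-- `u = (u₁,…,u_N)`, together with first and second derivatives `u', u''` on `[0,δ]`,
is a (twice continuously differentiable) solution of the boundary value problem (BVP):
`(1/2)σ_i² u_i'' + b_i u_i' = f_i` on `(0,δ)`, continuity at the vertex,
`η f(v) = ∑ ρ_i u_i'(0)`, and `u_i(δ) = 0`. -/
def IsBVPSolAux (N : ℕ) (δ η fv : ℝ) (ρ : Fin N → ℝ) (σ b f : Fin N → ℝ → ℝ)
    (u u' u'' : Fin N → ℝ → ℝ) : Prop :=
  (∀ i, ∀ x ∈ Icc (0:ℝ) δ, HasDerivWithinAt (u i) (u' i x) (Icc (0:ℝ) δ) x) ∧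
  (∀ i, ∀ x ∈ Icc (0:ℝ) δ, HasDerivWithinAt (u' i) (u'' i x) (Icc (0:ℝ) δ) x) ∧
  (∀ i, ContinuousOn (u'' i) (Icc (0:ℝ) δ)) ∧
  (∀ i, ∀ x ∈ Ioo (0:ℝ) δ, (1/2) * (σ i x)^2 * u'' i x + b i x * u' i x = f i x) ∧
  (∀ i j, u i 0 = u j 0) ∧
  (η * fv = ∑ i, ρ i * u' i 0) ∧
  (∀ i, u i δ = 0)

/-- `u` is a solution of the boundary value problem (BVP). -/
def IsBVPSol (N : ℕ) (δ η fv : ℝ) (ρ : Fin N → ℝ) (σ b f : Fin N → ℝ → ℝ)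
    (u : Fin N → ℝ → ℝ) : Prop :=
  ∃ u' u'' : Fin N → ℝ → ℝ, IsBVPSolAux N δ η fv ρ σ b f u u' u''

/-- The fundamental theorem of calculus on `[0,δ]` for a moving upper endpoint. -/
theorem hasDerivWithinAt_integral_right {δ x : ℝ} {g : ℝ → ℝ}
    (hg : ContinuousOn g (Icc 0 δ)) (hx : x ∈ Icc (0:ℝ) δ) :
    HasDerivWithinAt (fun y => ∫ z in (0:ℝ)..y, g z) (g x) (Icc 0 δ) x := by
  have : Fact (x ∈ Icc (0:ℝ) δ) := ⟨hx⟩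
  exact intervalIntegral.integral_hasDerivWithinAt_right
    ((hg.mono (Icc_subset_Icc_right hx.2)).intervalIntegrable_of_Icc hx.1)
    (hg.stronglyMeasurableAtFilter_nhdsWithin measurableSet_Icc x) (hg x hx)

/-- The fundamental theorem of calculus on `[0,δ]` for a moving lower endpoint. -/
theorem hasDerivWithinAt_integral_left {δ x : ℝ} {g : ℝ → ℝ}
    (hg : ContinuousOn g (Icc 0 δ)) (hx : x ∈ Icc (0:ℝ) δ) :
    HasDerivWithinAt (fun y => ∫ z in y..δ, g z) (-g x) (Icc 0 δ) x := by
  have : Fact (x ∈ Icc (0:ℝ) δ) := ⟨hx⟩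
  exact intervalIntegral.integral_hasDerivWithinAt_left
    ((hg.mono (Icc_subset_Icc_left hx.1)).intervalIntegrable_of_Icc hx.2)
    (hg.stronglyMeasurableAtFilter_nhdsWithin measurableSet_Icc x) (hg x hx)

/-- A function on `[0,δ]` with vanishing derivative is constant. -/
theorem eq_left_of_hasDerivWithinAt_zero {δ : ℝ} {h : ℝ → ℝ}
    (hh : ∀ x ∈ Icc (0:ℝ) δ, HasDerivWithinAt h 0 (Icc 0 δ) x) :
    ∀ x ∈ Icc (0:ℝ) δ, h x = h 0 :=
  constant_of_has_deriv_right_zero (fun x hx => (hh x hx).continuousWithinAt) fun x hx =>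
    (hh x (Ico_subset_Icc_self hx)).mono_of_mem_nhdsWithin <|
      Filter.mem_of_superset (Icc_mem_nhdsGE hx.2) (Icc_subset_Icc_left hx.1)

/-- The exponent `∫_0^x 2b(z)/σ(z)² dz` of the integrating factor. -/
def bvpExponent (σ b : ℝ → ℝ) (x : ℝ) : ℝ := ∫ z in (0:ℝ)..x, 2 * b z / (σ z)^2

/-- The inner integral `∫_0^x (2f(z)/σ(z)²) exp(∫_0^z 2b(s)/σ(s)² ds) dz` of `β`. -/
def bvpInner (σ b f : ℝ → ℝ) (x : ℝ) : ℝ :=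
  ∫ z in (0:ℝ)..x, (2 * f z / (σ z)^2) * Real.exp (bvpExponent σ b z)

section SingleEdge

variable {δ : ℝ} {σ b f : ℝ → ℝ}

theorem bvpExponent_zero : bvpExponent σ b 0 = 0 := intervalIntegral.integral_same

theorem bvpInner_zero : bvpInner σ b f 0 = 0 := intervalIntegral.integral_same

theorem bvpAlpha_right : bvpAlpha δ σ b δ = 0 := intervalIntegral.integral_same

theorem bvpBeta_right : bvpBeta δ σ b f δ = 0 := intervalIntegral.integral_same

theorem hasDerivWithinAt_bvpExponent (hσc : ContinuousOn σ (Icc 0 δ))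
    (hbc : ContinuousOn b (Icc 0 δ)) (hσ : ∀ x ∈ Icc (0:ℝ) δ, σ x ≠ 0)
    {x : ℝ} (hx : x ∈ Icc (0:ℝ) δ) :
    HasDerivWithinAt (bvpExponent σ b) (2 * b x / (σ x)^2) (Icc 0 δ) x :=
  hasDerivWithinAt_integral_right
    ((continuousOn_const.mul hbc).div (hσc.pow 2) fun y hy => pow_ne_zero 2 (hσ y hy)) hx

theorem continuousOn_bvpExponent (hσc : ContinuousOn σ (Icc 0 δ))
    (hbc : ContinuousOn b (Icc 0 δ)) (hσ : ∀ x ∈ Icc (0:ℝ) δ, σ x ≠ 0) :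
    ContinuousOn (bvpExponent σ b) (Icc 0 δ) :=
  fun _ hx => (hasDerivWithinAt_bvpExponent hσc hbc hσ hx).continuousWithinAt

theorem hasDerivWithinAt_bvpInner (hσc : ContinuousOn σ (Icc 0 δ))
    (hbc : ContinuousOn b (Icc 0 δ)) (hfc : ContinuousOn f (Icc 0 δ))
    (hσ : ∀ x ∈ Icc (0:ℝ) δ, σ x ≠ 0) {x : ℝ} (hx : x ∈ Icc (0:ℝ) δ) :
    HasDerivWithinAt (bvpInner σ b f)
      ((2 * f x / (σ x)^2) * Real.exp (bvpExponent σ b x)) (Icc 0 δ) x :=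
  hasDerivWithinAt_integral_right
    (((continuousOn_const.mul hfc).div (hσc.pow 2) fun y hy => pow_ne_zero 2 (hσ y hy)).mul
      (continuousOn_bvpExponent hσc hbc hσ).rexp) hx

theorem continuousOn_bvpInner (hσc : ContinuousOn σ (Icc 0 δ))
    (hbc : ContinuousOn b (Icc 0 δ)) (hfc : ContinuousOn f (Icc 0 δ))
    (hσ : ∀ x ∈ Icc (0:ℝ) δ, σ x ≠ 0) : ContinuousOn (bvpInner σ b f) (Icc 0 δ) :=
  fun _ hx => (hasDerivWithinAt_bvpInner hσc hbc hfc hσ hx).continuousWithinAt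

theorem hasDerivWithinAt_bvpAlpha (hσc : ContinuousOn σ (Icc 0 δ))
    (hbc : ContinuousOn b (Icc 0 δ)) (hσ : ∀ x ∈ Icc (0:ℝ) δ, σ x ≠ 0)
    {x : ℝ} (hx : x ∈ Icc (0:ℝ) δ) :
    HasDerivWithinAt (bvpAlpha δ σ b) (-Real.exp (-bvpExponent σ b x)) (Icc 0 δ) x :=
  hasDerivWithinAt_integral_left (continuousOn_bvpExponent hσc hbc hσ).neg.rexp hx

theorem hasDerivWithinAt_bvpBeta (hσc : ContinuousOn σ (Icc 0 δ))
    (hbc : ContinuousOn b (Icc 0 δ)) (hfc : ContinuousOn f (Icc 0 δ))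
    (hσ : ∀ x ∈ Icc (0:ℝ) δ, σ x ≠ 0) {x : ℝ} (hx : x ∈ Icc (0:ℝ) δ) :
    HasDerivWithinAt (bvpBeta δ σ b f)
      (-(bvpInner σ b f x * Real.exp (-bvpExponent σ b x))) (Icc 0 δ) x :=
  hasDerivWithinAt_integral_left ((continuousOn_bvpInner hσc hbc hfc hσ).mul
    (continuousOn_bvpExponent hσc hbc hσ).neg.rexp) hx

theorem bvpAlpha_zero_pos (hδ : 0 < δ) (hσc : ContinuousOn σ (Icc 0 δ))
    (hbc : ContinuousOn b (Icc 0 δ)) (hσ : ∀ x ∈ Icc (0:ℝ) δ, σ x ≠ 0) :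
    0 < bvpAlpha δ σ b 0 :=
  intervalIntegral.intervalIntegral_pos_of_pos_on
    ((continuousOn_bvpExponent hσc hbc hσ).neg.rexp.intervalIntegrable_of_Icc hδ.le)
    (fun _ _ => Real.exp_pos _) hδ

/-- The derivative `(c + ∫_0^x …) exp(−∫_0^x 2b/σ²)` of the general solution of the equation on
one edge. -/
def bvpSlope (σ b f : ℝ → ℝ) (c x : ℝ) : ℝ :=
  (c + bvpInner σ b f x) * Real.exp (-bvpExponent σ b x)

theorem bvpSlope_zero (c : ℝ) : bvpSlope σ b f c 0 = c := by
  simp [bvpSlope, bvpInner_zero, bvpExponent_zero]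

theorem hasDerivWithinAt_bvpSlope (hσc : ContinuousOn σ (Icc 0 δ))
    (hbc : ContinuousOn b (Icc 0 δ)) (hfc : ContinuousOn f (Icc 0 δ))
    (hσ : ∀ x ∈ Icc (0:ℝ) δ, σ x ≠ 0) (c : ℝ) {x : ℝ} (hx : x ∈ Icc (0:ℝ) δ) :
    HasDerivWithinAt (bvpSlope σ b f c)
      ((2 * f x - 2 * b x * bvpSlope σ b f c x) / (σ x)^2) (Icc 0 δ) x := by
  have h := ((hasDerivWithinAt_bvpInner hσc hbc hfc hσ hx).const_add c).mul
    (hasDerivWithinAt_bvpExponent hσc hbc hσ hx).neg.exp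
  refine h.congr_deriv ?_
  have he : Real.exp (bvpExponent σ b x) * Real.exp (-bvpExponent σ b x) = 1 := by
    rw [← Real.exp_add, add_neg_cancel, Real.exp_zero]
  simp only [bvpSlope, Pi.neg_apply]
  linear_combination (2 * f x / (σ x)^2) * he

theorem hasDerivWithinAt_bvpGeneralSolution (hσc : ContinuousOn σ (Icc 0 δ))
    (hbc : ContinuousOn b (Icc 0 δ)) (hfc : ContinuousOn f (Icc 0 δ))
    (hσ : ∀ x ∈ Icc (0:ℝ) δ, σ x ≠ 0) (c : ℝ) {x : ℝ} (hx : x ∈ Icc (0:ℝ) δ) :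
    HasDerivWithinAt (fun y => -c * bvpAlpha δ σ b y - bvpBeta δ σ b f y)
      (bvpSlope σ b f c x) (Icc 0 δ) x := by
  refine (((hasDerivWithinAt_bvpAlpha hσc hbc hσ hx).const_mul (-c)).sub
    (hasDerivWithinAt_bvpBeta hσc hbc hfc hσ hx)).congr_deriv ?_
  simp only [bvpSlope]
  ring

/-- A `C²` solution of the equation on one edge has the derivative given by variation of
constants. -/
theorem deriv_eq_bvpSlope (hδ : 0 < δ) (hσc : ContinuousOn σ (Icc 0 δ))
    (hbc : ContinuousOn b (Icc 0 δ)) (hfc : ContinuousOn f (Icc 0 δ))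
    (hσ : ∀ x ∈ Icc (0:ℝ) δ, σ x ≠ 0) {v v' : ℝ → ℝ}
    (hv : ∀ x ∈ Icc (0:ℝ) δ, HasDerivWithinAt v (v' x) (Icc 0 δ) x)
    (hv' : ContinuousOn v' (Icc 0 δ))
    (hode : ∀ x ∈ Ioo (0:ℝ) δ, (1/2) * (σ x)^2 * v' x + b x * v x = f x) :
    ∀ x ∈ Icc (0:ℝ) δ, v x = bvpSlope σ b f (v 0) x := by
  have hvc : ContinuousOn v (Icc 0 δ) := fun x hx => (hv x hx).continuousWithinAt
  have hode' : EqOn (fun x => (1/2) * (σ x)^2 * v' x + b x * v x) f (Icc 0 δ) :=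
    EqOn.of_subset_closure (s := Ioo 0 δ) hode (by fun_prop) hfc Ioo_subset_Icc_self
      (closure_Ioo hδ.ne).ge
  have hconst := eq_left_of_hasDerivWithinAt_zero (δ := δ)
    (h := fun x => (v x - bvpSlope σ b f (v 0) x) * Real.exp (bvpExponent σ b x)) ?_
  · intro x hx
    have h := hconst x hx
    simpa [bvpSlope_zero, sub_eq_zero] using h
  · intro x hx
    refine (((hv x hx).sub (hasDerivWithinAt_bvpSlope hσc hbc hfc hσ (v 0) hx)).mul
      (hasDerivWithinAt_bvpExponent hσc hbc hσ hx).exp).congr_deriv ?_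
    have hne := hσ x hx
    have ho : (1/2) * (σ x)^2 * v' x + b x * v x = f x := hode' hx
    simp only [Pi.sub_apply]
    field_simp
    linear_combination 2 * Real.exp (bvpExponent σ b x) * ho

/-- A `C²` solution of the equation on one edge vanishing at `δ` is `−u'(0) α − β`. -/
theorem eq_bvpGeneralSolution (hδ : 0 < δ) (hσc : ContinuousOn σ (Icc 0 δ))
    (hbc : ContinuousOn b (Icc 0 δ)) (hfc : ContinuousOn f (Icc 0 δ))
    (hσ : ∀ x ∈ Icc (0:ℝ) δ, σ x ≠ 0) {u u' u'' : ℝ → ℝ}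
    (hu : ∀ x ∈ Icc (0:ℝ) δ, HasDerivWithinAt u (u' x) (Icc 0 δ) x)
    (hu' : ∀ x ∈ Icc (0:ℝ) δ, HasDerivWithinAt u' (u'' x) (Icc 0 δ) x)
    (hu'' : ContinuousOn u'' (Icc 0 δ))
    (hode : ∀ x ∈ Ioo (0:ℝ) δ, (1/2) * (σ x)^2 * u'' x + b x * u' x = f x)
    (hend : u δ = 0) :
    ∀ x ∈ Icc (0:ℝ) δ, u x = -(u' 0) * bvpAlpha δ σ b x - bvpBeta δ σ b f x := by
  have hconst := eq_left_of_hasDerivWithinAt_zero (δ := δ)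
    (h := fun x => u x - (-(u' 0) * bvpAlpha δ σ b x - bvpBeta δ σ b f x)) fun x hx =>
      ((hu x hx).sub (hasDerivWithinAt_bvpGeneralSolution hσc hbc hfc hσ (u' 0) hx)).congr_deriv
        (sub_eq_zero.2 (deriv_eq_bvpSlope hδ hσc hbc hfc hσ hu' hu'' hode x hx))
  intro x hx
  have h := (hconst x hx).trans (hconst δ (right_mem_Icc.2 hδ.le)).symm
  simp only [hend, bvpAlpha_right, bvpBeta_right] at h
  linarith

end SingleEdge

/-- The vertex conditions for the edgewise general solutions, as a linear system for the
slopes `c`, have the explicit solution `κ / α`. -/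
theorem vertex_conditions_iff {ι : Type*} [Fintype ι] {ρ A β : ι → ℝ} (hρ : ∀ i, 0 < ρ i)
    (hA : ∀ i, 0 < A i) (i₀ : ι) (q : ℝ) (c : ι → ℝ) :
    ((∀ i j, -c i * A i - β i = -c j * A j - β j) ∧ q = ∑ i, ρ i * c i) ↔
      ∀ i, c i = ((q - ∑ j, ρ j * (β i₀ - β j) / A j) * (∑ j, ρ j / A j)⁻¹ + β i₀ - β i) / A i := by
  have hS : (∑ j, ρ j / A j) ≠ 0 :=
    (Finset.sum_pos (fun j _ => div_pos (hρ j) (hA j)) ⟨i₀, Finset.mem_univ _⟩).ne'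
  have hsum (K : ℝ) : ∑ i, ρ i * ((K + β i₀ - β i) / A i) =
      K * (∑ j, ρ j / A j) + ∑ j, ρ j * (β i₀ - β j) / A j := by
    rw [Finset.mul_sum, ← Finset.sum_add_distrib]
    exact Finset.sum_congr rfl fun i _ => by ring
  constructor
  · rintro ⟨hc, hq⟩ i
    have hci (i : ι) : c i = (c i₀ * A i₀ + β i₀ - β i) / A i := by
      rw [eq_div_iff (hA i).ne']
      linarith [hc i i₀]
    have hK : c i₀ * A i₀ = (q - ∑ j, ρ j * (β i₀ - β j) / A j) * (∑ j, ρ j / A j)⁻¹ := by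
      rw [← div_eq_mul_inv, eq_div_iff hS, eq_sub_iff_add_eq, ← hsum, hq]
      exact Finset.sum_congr rfl fun i _ => by rw [← hci i]
    rw [← hK]
    exact hci i
  · intro hc
    refine ⟨fun i j => ?_, ?_⟩
    · rw [hc i, hc j, neg_mul, neg_mul, div_mul_cancel₀ _ (hA i).ne',
        div_mul_cancel₀ _ (hA j).ne']
      ring
    · simp_rw [hc]
      rw [hsum, inv_mul_cancel_right₀ hS]
      ring

/-- The boundary value problem admits exactly one solution, given explicitly
by `u_i(x) = −κ_i α_i(x)/α_i(0) − β_i(x)` for all `x ∈ [0,δ]` and all `i`. -/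
theorem stmt_2 (N : ℕ) (hN : 0 < N) (δ η σ₀ : ℝ) (hδ : 0 < δ) (hη : 0 ≤ η) (hσ₀ : 0 < σ₀)
    (ρ : Fin N → ℝ) (hρpos : ∀ i, 0 < ρ i) (hρsum : ∑ i, ρ i = 1)
    (σ b f : Fin N → ℝ → ℝ)
    (hσc : ∀ i, ContinuousOn (σ i) (Icc 0 δ)) (hbc : ∀ i, ContinuousOn (b i) (Icc 0 δ))
    (hfc : ∀ i, ContinuousOn (f i) (Icc 0 δ))
    (hσ : ∀ i, ∀ x ∈ Icc (0:ℝ) δ, σ₀ ≤ σ i x)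
    (fv : ℝ) (hfv : ∀ i, f i 0 = fv) :
    IsBVPSol N δ η fv ρ σ b f
      (fun i x => -(bvpKappa N hN δ η fv ρ σ b f i) * bvpAlpha δ (σ i) (b i) x
          / bvpAlpha δ (σ i) (b i) 0 - bvpBeta δ (σ i) (b i) (f i) x) ∧
    (∀ u : Fin N → ℝ → ℝ, IsBVPSol N δ η fv ρ σ b f u →
      ∀ i, ∀ x ∈ Icc (0:ℝ) δ,
        u i x = -(bvpKappa N hN δ η fv ρ σ b f i) * bvpAlpha δ (σ i) (b i) x
            / bvpAlpha δ (σ i) (b i) 0 - bvpBeta δ (σ i) (b i) (f i) x) := by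
  have hσ' (i : Fin N) : ∀ x ∈ Icc (0:ℝ) δ, σ i x ≠ 0 := fun x hx => (hσ₀.trans_le (hσ i x hx)).ne'
  have hα (i : Fin N) : 0 < bvpAlpha δ (σ i) (b i) 0 :=
    bvpAlpha_zero_pos hδ (hσc i) (hbc i) (hσ' i)
  have hvertex := vertex_conditions_iff (β := fun j => bvpBeta δ (σ j) (b j) (f j) 0) hρpos hα
    ⟨0, hN⟩ (η * fv)
  have hform (i : Fin N) (x : ℝ) : -(bvpKappa N hN δ η fv ρ σ b f i) * bvpAlpha δ (σ i) (b i) x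
      / bvpAlpha δ (σ i) (b i) 0 - bvpBeta δ (σ i) (b i) (f i) x =
      -(bvpKappa N hN δ η fv ρ σ b f i / bvpAlpha δ (σ i) (b i) 0) * bvpAlpha δ (σ i) (b i) x
        - bvpBeta δ (σ i) (b i) (f i) x := by ring
  simp only [hform]
  constructor
  · obtain ⟨hcont, hkirchhoff⟩ := (hvertex fun i =>
      bvpKappa N hN δ η fv ρ σ b f i / bvpAlpha δ (σ i) (b i) 0).2 fun i => rfl
    refine ⟨fun i => bvpSlope (σ i) (b i) (f i)
        (bvpKappa N hN δ η fv ρ σ b f i / bvpAlpha δ (σ i) (b i) 0),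
      fun i x => (2 * f i x - 2 * b i x * bvpSlope (σ i) (b i) (f i)
        (bvpKappa N hN δ η fv ρ σ b f i / bvpAlpha δ (σ i) (b i) 0) x) / (σ i x)^2,
      fun i x hx => hasDerivWithinAt_bvpGeneralSolution (hσc i) (hbc i) (hfc i) (hσ' i) _ hx,
      fun i x hx => hasDerivWithinAt_bvpSlope (hσc i) (hbc i) (hfc i) (hσ' i) _ hx,
      fun i => ?_, fun i x hx => ?_, hcont, ?_, fun i => ?_⟩
    · have hslope : ContinuousOn (bvpSlope (σ i) (b i) (f i)
          (bvpKappa N hN δ η fv ρ σ b f i / bvpAlpha δ (σ i) (b i) 0)) (Icc 0 δ) := fun x hx =>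
        (hasDerivWithinAt_bvpSlope (hσc i) (hbc i) (hfc i) (hσ' i) _ hx).continuousWithinAt
      exact ((continuousOn_const.mul (hfc i)).sub ((continuousOn_const.mul (hbc i)).mul
        hslope)).div ((hσc i).pow 2) fun x hx => pow_ne_zero 2 (hσ' i x hx)
    · have hne := hσ' i x (Ioo_subset_Icc_self hx)
      field_simp
      ring
    · simpa only [bvpSlope_zero] using hkirchhoff
    · simp only [bvpAlpha_right, bvpBeta_right, mul_zero, sub_zero]
  · rintro u ⟨u', u'', hu, hu', hu'', hode, hcont, hkirchhoff, hend⟩ i x hx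
    have hsol (i : Fin N) := eq_bvpGeneralSolution hδ (hσc i) (hbc i) (hfc i) (hσ' i) (hu i)
      (hu' i) (hu'' i) (hode i) (hend i)
    have hslope := (hvertex fun i => u' i 0).1 ⟨fun i j => by
      rw [← hsol i 0 (left_mem_Icc.2 hδ.le), ← hsol j 0 (left_mem_Icc.2 hδ.le), hcont i j],
      hkirchhoff⟩ i
    rw [hsol i x hx, hslope]
    rfl

end
end

section
/- Suppose v = (v₁,…,v_N), with each v_i twice continuously differentiable on [0,δ], satisfies (1/2)σ_i(x)² v_i''(x) + b_i(x) v_i'(x) = 0 for all x ∈ (0,δ) and all i, v_i(0) = v_j(0) for all i,j, ∑_{i=1}^N ρ_i v_i'(0) = 0, and v_i(δ) = 0 for all i. Then v_i(x) = 0 for all i and all x ∈ [0,δ]. -/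
open Set

/-- A function continuous on `[0, δ]` with `w' = a w` on `(0, δ)`, where `a` is continuous on
`[0, δ]`, is its initial value times a positive function. -/
theorem exists_pos_eq_mul_of_linear_ode {δ : ℝ} (hδ : 0 < δ) {a w : ℝ → ℝ}
    (ha : ContinuousOn a (Icc 0 δ)) (hw : ContinuousOn w (Icc 0 δ))
    (hderiv : ∀ x ∈ Ioo 0 δ, HasDerivAt w (a x * w x) x) :
    ∃ g : ℝ → ℝ, (∀ x, 0 < g x) ∧ ∀ x ∈ Icc 0 δ, w x = w 0 * g x := by
  set e : ℝ → ℝ := IccExtend hδ.le ((Icc 0 δ).domRestrict a) with he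
  have hec : Continuous e := ha.domRestrict.Icc_extend'
  set A : ℝ → ℝ := fun x => ∫ t in (0 : ℝ)..x, e t with hA
  have hAd : ∀ x, HasDerivAt A (e x) x := fun x => (hec.integral_hasStrictDerivAt 0 x).hasDerivAt
  have hAc : Continuous A := continuous_iff_continuousAt.2 fun x => (hAd x).continuousAt
  refine ⟨fun x => Real.exp (A x), fun x => Real.exp_pos _, fun x hx => ?_⟩
  have hconst : w x * Real.exp (-A x) = w 0 := by
    rcases hx.1.eq_or_lt with rfl | h0
    · simp [hA]
    obtain ⟨c, hc, hslope⟩ := exists_hasDerivAt_eq_slope (fun x => w x * Real.exp (-A x))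
      (fun _ => 0) h0
      ((hw.mono (Icc_subset_Icc_right hx.2)).mul (Real.continuous_exp.comp hAc.neg).continuousOn)
      (fun y hy => by
        have hy' : y ∈ Ioo 0 δ := ⟨hy.1, hy.2.trans_le hx.2⟩
        have hey : e y = a y := by
          rw [he, IccExtend_of_mem _ _ (Ioo_subset_Icc_self hy'), domRestrict_apply]
        refine ((hderiv y hy').mul (hAd y).neg.exp).congr_deriv ?_
        simp only [hey, Pi.neg_apply]
        ring)
    have hA0 : A 0 = 0 := by simp [hA]
    rw [eq_comm, div_eq_zero_iff, sub_eq_zero] at hslope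
    simpa [hA0] using hslope.resolve_right (by linarith)
  rw [← hconst, mul_assoc, ← Real.exp_add, neg_add_cancel, Real.exp_zero, mul_one]

/-- If `v = (v₁,…,v_N)` is twice continuously differentiable on `[0,δ]` and
satisfies the homogeneous ODE `(1/2)σ_i² v_i'' + b_i v_i' = 0` on `(0,δ)`, is continuous at the
vertex, satisfies the Kirchhoff condition `∑ ρ_i v_i'(0) = 0` and the Dirichlet condition
`v_i(δ) = 0`, then `v ≡ 0` on `[0,δ]`. -/
theorem stmt_3 (N : ℕ) (hN : 0 < N) (δ σ₀ : ℝ) (hδ : 0 < δ) (hσ₀ : 0 < σ₀)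
    (ρ : Fin N → ℝ) (hρpos : ∀ i, 0 < ρ i) (hρsum : ∑ i, ρ i = 1)
    (σ b : Fin N → ℝ → ℝ)
    (hσc : ∀ i, ContinuousOn (σ i) (Icc 0 δ)) (hbc : ∀ i, ContinuousOn (b i) (Icc 0 δ))
    (hσ : ∀ i, ∀ x ∈ Icc (0:ℝ) δ, σ₀ ≤ σ i x)
    (v v' v'' : Fin N → ℝ → ℝ)
    (hd1 : ∀ i, ∀ x ∈ Icc (0:ℝ) δ, HasDerivWithinAt (v i) (v' i x) (Icc (0:ℝ) δ) x)
    (hd2 : ∀ i, ∀ x ∈ Icc (0:ℝ) δ, HasDerivWithinAt (v' i) (v'' i x) (Icc (0:ℝ) δ) x)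
    (hcont : ∀ i, ContinuousOn (v'' i) (Icc (0:ℝ) δ))
    (hode : ∀ i, ∀ x ∈ Ioo (0:ℝ) δ, (1/2) * (σ i x)^2 * v'' i x + b i x * v' i x = 0)
    (hvert : ∀ i j, v i 0 = v j 0)
    (hkirch : ∑ i, ρ i * v' i 0 = 0)
    (hbdry : ∀ i, v i δ = 0) :
    ∀ i, ∀ x ∈ Icc (0:ℝ) δ, v i x = 0 := by
  have hv'At : ∀ i, ∀ x ∈ Ioo 0 δ, HasDerivAt (v i) (v' i x) x := fun i x hx =>
    (hd1 i x (Ioo_subset_Icc_self hx)).hasDerivAt (Icc_mem_nhds hx.1 hx.2)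
  have hvc : ∀ i, ContinuousOn (v i) (Icc 0 δ) := fun i x hx => (hd1 i x hx).continuousWithinAt
  have hσpos : ∀ i, ∀ x ∈ Icc 0 δ, 0 < σ i x := fun i x hx => hσ₀.trans_le (hσ i x hx)
  have hfactor : ∀ i, ∃ g : ℝ → ℝ, (∀ x, 0 < g x) ∧ ∀ x ∈ Icc 0 δ, v' i x = v' i 0 * g x := by
    intro i
    refine exists_pos_eq_mul_of_linear_ode (a := fun x => -(2 * b i x) / σ i x ^ 2) hδ
      ((continuousOn_const.mul (hbc i)).neg.div ((hσc i).pow 2)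
        fun x hx => (pow_pos (hσpos i x hx) 2).ne')
      (fun x hx => (hd2 i x hx).continuousWithinAt) fun x hx => ?_
    have hx' := Ioo_subset_Icc_self hx
    refine ((hd2 i x hx').hasDerivAt (Icc_mem_nhds hx.1 hx.2)).congr_deriv ?_
    have := (hσpos i x hx').ne'
    field_simp
    linarith [hode i x hx]
  choose g hgpos hg using hfactor
  have hsign : ∀ i, ∃ k > 0, v i 0 = -(v' i 0 * k) := by
    intro i
    obtain ⟨c, hc, hslope⟩ := exists_hasDerivAt_eq_slope (v i) (v' i) hδ (hvc i) (hv'At i)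
    refine ⟨g i c * δ, mul_pos (hgpos i c) hδ, ?_⟩
    rw [hg i c (Ioo_subset_Icc_self hc), hbdry, eq_div_iff (by linarith)] at hslope
    linarith
  choose k hkpos hk using hsign
  have hv'0 : ∀ i, v' i 0 = 0 := by
    intro i
    have hsum : ∑ j, ρ j * (v' j 0 ^ 2 * k j) = 0 := by
      calc ∑ j, ρ j * (v' j 0 ^ 2 * k j) = ∑ j, -v i 0 * (ρ j * v' j 0) :=
            Finset.sum_congr rfl fun j _ => by rw [hvert i j, hk j]; ring
        _ = 0 := by rw [← Finset.mul_sum, hkirch, mul_zero]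
    have hterm := (Finset.sum_eq_zero_iff_of_nonneg fun j _ =>
      mul_nonneg (hρpos j).le (mul_nonneg (sq_nonneg _) (hkpos j).le)).1 hsum i (Finset.mem_univ i)
    simpa [(hρpos i).ne', (hkpos i).ne'] using hterm
  intro i x hx
  rcases hx.2.eq_or_lt with rfl | hxδ
  · exact hbdry i
  obtain ⟨c, hc, hslope⟩ := exists_hasDerivAt_eq_slope (v i) (v' i) hxδ
    ((hvc i).mono (Icc_subset_Icc_left hx.1)) fun y hy => hv'At i y ⟨hx.1.trans_lt hy.1, hy.2⟩
  rw [hg i c ⟨hx.1.trans hc.1.le, hc.2.le⟩, hv'0, hbdry, eq_div_iff (by linarith)] at hslope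
  linarith
end

section
/- There exist δ₀ > 0 and C > 0, depending only on σ₀, η, B and F, such that for every 0 < δ ≤ δ₀ the unique solution u^δ = (u^δ₁,…,u^δ_N) of the boundary value problem on [0,δ] satisfies max_{1≤i≤N} sup_{x∈[0,δ]} |(u^δ_i)''(x)| ≤ C. -/
open Set

/-- If `u` vanishes at `δ` and `|u''| ≤ L` on `[0,δ]`, then `u'` stays within `δ L` of the
slope `-u(0)/δ`. -/
theorem abs_deriv_add_div_le {δ L : ℝ} (hδ : 0 < δ) {u u' u'' : ℝ → ℝ}
    (hu : ∀ x ∈ Icc (0:ℝ) δ, HasDerivWithinAt u (u' x) (Icc (0:ℝ) δ) x)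
    (hu' : ∀ x ∈ Icc (0:ℝ) δ, HasDerivWithinAt u' (u'' x) (Icc (0:ℝ) δ) x)
    (hL : ∀ x ∈ Icc (0:ℝ) δ, |u'' x| ≤ L) (hend : u δ = 0) {x : ℝ} (hx : x ∈ Icc (0:ℝ) δ) :
    |u' x + u 0 / δ| ≤ δ * L := by
  obtain ⟨y, hy, hslope⟩ := exists_hasDerivAt_eq_slope u u' hδ
    (fun x hx => (hu x hx).continuousWithinAt)
    (fun x hx => (hu x (Ioo_subset_Icc_self hx)).hasDerivAt (Icc_mem_nhds hx.1 hx.2))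
  have hyI := Ioo_subset_Icc_self hy
  have hlip := (convex_Icc (0:ℝ) δ).norm_image_sub_le_of_norm_hasDerivWithin_le hu' hL hyI hx
  have hL0 : 0 ≤ L := (abs_nonneg _).trans (hL x hx)
  have hxy : |x - y| ≤ δ := by
    rw [abs_le]
    constructor <;> linarith [hx.1, hx.2, hyI.1, hyI.2]
  have heq : u' x + u 0 / δ = u' x - u' y := by
    rw [hslope, hend]
    ring
  rw [heq]
  calc |u' x - u' y| ≤ L * |x - y| := hlip
    _ ≤ L * δ := by gcongr
    _ = δ * L := mul_comm _ _

/-- A finite family of continuous functions on `[0,δ]` attains its joint maximal modulus. -/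
theorem exists_forall_abs_le_of_continuousOn {ι : Type*} [Finite ι] [Nonempty ι] {δ : ℝ}
    (hδ : 0 ≤ δ) {g : ι → ℝ → ℝ} (hg : ∀ i, ContinuousOn (g i) (Icc 0 δ)) :
    ∃ j, ∃ y ∈ Icc (0:ℝ) δ, ∀ i, ∀ x ∈ Icc (0:ℝ) δ, |g i x| ≤ |g j y| := by
  have hmax : ∀ i, ∃ y ∈ Icc (0:ℝ) δ, ∀ x ∈ Icc (0:ℝ) δ, |g i x| ≤ |g i y| := fun i =>
    isCompact_Icc.exists_isMaxOn (nonempty_Icc.2 hδ) (hg i).abs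
  choose y hy hmax using hmax
  obtain ⟨j, hj⟩ := Finite.exists_max fun i => |g i (y i)|
  exact ⟨j, y j, hy j, fun i x hx => (hmax i x hx).trans (hj i)⟩

/-- The equation `(1/2) s² p + b q = f` with `s ≥ σ₀ > 0` bounds `p` in terms of `q`. -/
theorem abs_le_of_half_sq_mul_add_eq {σ₀ B F s b f p q : ℝ} (hσ₀ : 0 < σ₀) (hs : σ₀ ≤ s)
    (hb : |b| ≤ B) (hf : |f| ≤ F) (h : (1/2) * s^2 * p + b * q = f) :
    |p| ≤ 2 / σ₀^2 * (F + B * |q|) := by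
  have hsq : s^2 * |p| ≤ 2 * (F + B * |q|) := by
    calc s^2 * |p| = |2 * (f - b * q)| := by
          rw [← abs_of_nonneg (sq_nonneg s), ← abs_mul]
          congr 1
          linarith
      _ = 2 * |f - b * q| := by rw [abs_mul, abs_two]
      _ ≤ 2 * (|f| + |b| * |q|) := by
          have := abs_sub f (b * q)
          rw [abs_mul] at this
          linarith
      _ ≤ 2 * (F + B * |q|) := by gcongr
  have hle : σ₀^2 * |p| ≤ s^2 * |p| := by gcongr
  rw [div_mul_eq_mul_div, le_div_iff₀ (by positivity)]
  linarith

/-- There exist `δ₀ > 0` and `C > 0`, depending only on `σ₀`, `η`, `B` and `F`,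
such that for every `0 < δ ≤ δ₀` the (unique) solution `u^δ` of the boundary value problem on
`[0,δ]` satisfies `max_i sup_{x∈[0,δ]} |(u^δ_i)''(x)| ≤ C`. -/
theorem stmt_4 (σ₀ η B F : ℝ) (hσ₀ : 0 < σ₀) (hη : 0 ≤ η) (hB : 0 < B) (hF : 0 < F) :
    ∃ δ₀ > (0:ℝ), ∃ C > (0:ℝ),
      ∀ (N : ℕ) (hN : 0 < N)
        (ρ : Fin N → ℝ), (∀ i, 0 < ρ i) → (∑ i, ρ i = 1) →
      ∀ σ b f : Fin N → ℝ → ℝ,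
        (∀ i, ContinuousOn (σ i) (Ici 0)) →
        (∀ i, ContinuousOn (b i) (Ici 0)) →
        (∀ i, ContinuousOn (f i) (Ici 0)) →
        (∀ i, ∃ M, ∀ x ∈ Ici (0:ℝ), σ i x ≤ M) →
        (∀ i, ∀ x ∈ Ici (0:ℝ), σ₀ ≤ σ i x) →
        (∀ i, ∀ x ∈ Ici (0:ℝ), |b i x| ≤ B) →
        (∀ i, ∀ x ∈ Ici (0:ℝ), |f i x| ≤ F) →
      ∀ fv : ℝ, (∀ i, f i 0 = fv) →
      ∀ δ : ℝ, 0 < δ → δ ≤ δ₀ →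
      ∀ u u' u'' : Fin N → ℝ → ℝ,
        IsBVPSolAux N δ η fv ρ σ b f u u' u'' →
        ∀ i, ∀ x ∈ Icc (0:ℝ) δ, |u'' i x| ≤ C := by
  refine ⟨σ₀^2 / (12 * B), by positivity, 2 / σ₀^2 * (2 * F + 2 * B * η * F), by positivity, ?_⟩
  intro N hN ρ hρ hρ1 σ b f _ _ _ _ hσ hb hf fv hfv δ hδ hδ₀ u u' u'' hu i x hx
  obtain ⟨hu1, hu2, hcont, hode, hvertex, hkirchhoff, hend⟩ := hu
  have : Nonempty (Fin N) := ⟨i⟩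
  have hcont' : ∀ i, ContinuousOn (u' i) (Icc 0 δ) :=
    fun i x hx => (hu2 i x hx).continuousWithinAt
  have hode_le : ∀ i, ∀ x ∈ Icc (0:ℝ) δ, |u'' i x| ≤ 2 / σ₀^2 * (F + B * |u' i x|) := by
    intro i x hx
    rw [← closure_Ioo hδ.ne] at hx
    refine le_on_closure (s := Ioo 0 δ) (f := fun x => |u'' i x|)
      (g := fun x => 2 / σ₀^2 * (F + B * |u' i x|)) (fun z hz => ?_) ?_ ?_ hx
    · have hz0 : z ∈ Ici (0:ℝ) := hz.1.le
      exact abs_le_of_half_sq_mul_add_eq hσ₀ (hσ i z hz0) (hb i z hz0) (hf i z hz0) (hode i z hz)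
    · rw [closure_Ioo hδ.ne]
      exact (hcont i).abs
    · rw [closure_Ioo hδ.ne]
      exact continuousOn_const.mul (continuousOn_const.add (continuousOn_const.mul (hcont' i).abs))
  obtain ⟨j, y, hy, hmax⟩ := exists_forall_abs_le_of_continuousOn hδ.le hcont'
  set M := |u' j y| with hM
  set L := 2 / σ₀^2 * (F + B * M) with hL
  have hbound : ∀ i, ∀ x ∈ Icc (0:ℝ) δ, |u'' i x| ≤ L := fun i x hx =>
    (hode_le i x hx).trans (by rw [hL]; gcongr; exact hmax i x hx)
  have hslope : ∀ i, ∀ x ∈ Icc (0:ℝ) δ, |u' i x + u j 0 / δ| ≤ δ * L := by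
    intro i x hx
    rw [hvertex j i]
    exact abs_deriv_add_div_le hδ (hu1 i) (hu2 i) (hbound i) (hend i) hx
  have hmean : |η * fv + u j 0 / δ| ≤ δ * L := by
    have heq : η * fv + u j 0 / δ = ∑ i, ρ i * (u' i 0 + u j 0 / δ) := by
      simp only [mul_add, Finset.sum_add_distrib, ← Finset.sum_mul, hρ1, hkirchhoff, one_mul]
    rw [heq]
    calc |∑ i, ρ i * (u' i 0 + u j 0 / δ)| ≤ ∑ i, |ρ i * (u' i 0 + u j 0 / δ)| :=
          Finset.abs_sum_le_sum_abs _ _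
      _ ≤ ∑ i, ρ i * (δ * L) := Finset.sum_le_sum fun i _ => by
          rw [abs_mul, abs_of_pos (hρ i)]
          exact mul_le_mul_of_nonneg_left (hslope i 0 ⟨le_rfl, hδ.le⟩) (hρ i).le
      _ = δ * L := by rw [← Finset.sum_mul, hρ1, one_mul]
  have hfv' : |η * fv| ≤ η * F := by
    rw [abs_mul, abs_of_nonneg hη, ← hfv i]
    exact mul_le_mul_of_nonneg_left (hf i 0 self_mem_Ici) hη
  have hM_le : M ≤ η * F + 2 * (δ * L) := by
    have h1 := abs_le.1 (hslope j y hy)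
    have h2 := abs_le.1 hmean
    have h3 := abs_le.1 hfv'
    rw [hM, abs_le]
    constructor <;> linarith
  have hδL : B * (δ * L) ≤ (F + B * M) / 6 := by
    calc B * (δ * L) ≤ B * (σ₀^2 / (12 * B) * L) := by gcongr
      _ = (F + B * M) / 6 := by
          rw [hL]
          field_simp
          ring
  have hBM : B * M ≤ F + 2 * B * η * F := by
    have h1 := mul_le_mul_of_nonneg_left hM_le hB.le
    have h2 : 0 ≤ B * η * F := by positivity
    linarith
  calc |u'' i x| ≤ L := hbound i x hx
    _ ≤ 2 / σ₀^2 * (2 * F + 2 * B * η * F) := by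
        rw [hL]
        refine mul_le_mul_of_nonneg_left ?_ (by positivity)
        linarith
end

section
/- If u = (u₁,…,u_N) is a solution of the boundary value problem (BVP), then |u₁(0) + η f(v) δ| ≤ (δ²/2) · max_{1≤i≤N} sup_{x∈[0,δ]} |u_i''(x)|. -/
open Set

/-- First-order Taylor estimate on `[0,δ]` with a uniform bound on the second derivative. -/
lemma abs_taylor_one_le {δ C : ℝ} (hδ : 0 < δ) {w w' w'' : ℝ → ℝ}
    (hw : ∀ x ∈ Icc (0:ℝ) δ, HasDerivWithinAt w (w' x) (Icc 0 δ) x)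
    (hw' : ∀ x ∈ Icc (0:ℝ) δ, HasDerivWithinAt w' (w'' x) (Icc 0 δ) x)
    (hC : ∀ x ∈ Icc (0:ℝ) δ, |w'' x| ≤ C) :
    |w δ - w 0 - w' 0 * δ| ≤ δ ^ 2 / 2 * C := by
  have hderiv : ∀ x ∈ Icc (0:ℝ) δ, |w' x - w' 0| ≤ C * x := fun x hx => by
    have h := (convex_Icc (0:ℝ) δ).norm_image_sub_le_of_norm_hasDerivWithin_le hw'
      (fun y hy => hC y hy) (left_mem_Icc.2 hδ.le) hx
    simpa [abs_of_nonneg hx.1] using h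
  have hg : ∀ x ∈ Icc (0:ℝ) δ,
      HasDerivWithinAt (fun y => w y - w 0 - w' 0 * y) (w' x - w' 0) (Icc 0 δ) x := fun x hx => by
    simpa using ((hw x hx).sub_const (w 0)).fun_sub ((hasDerivWithinAt_id x _).const_mul (w' 0))
  have h := image_norm_le_of_norm_deriv_right_le_deriv_boundary
    (f := fun y => w y - w 0 - w' 0 * y) (f' := fun x => w' x - w' 0)
    (B := fun x => x ^ 2 / 2 * C) (B' := fun x => C * x)
    (fun x hx => (hg x hx).continuousWithinAt)
    (fun x hx => (hg x (Ico_subset_Icc_self hx)).mono_of_mem_nhdsWithin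
      (Icc_mem_nhdsGE_of_mem hx))
    (by simp)
    (fun x => (((hasDerivAt_pow 2 x).div_const 2).mul_const C).congr_deriv (by
      push_cast
      ring))
    (fun x hx => hderiv x (Ico_subset_Icc_self hx))
    (right_mem_Icc.2 hδ.le)
  exact h

/-- If `u` is a solution of the boundary value problem (BVP), then
`|u₁(0) + η f(v) δ| ≤ (δ²/2) · max_i sup_{x∈[0,δ]} |u_i''(x)|` (expressed here via an
arbitrary uniform bound `C` on the second derivatives). -/
theorem stmt_7 (N : ℕ) (hN : 0 < N) (δ η σ₀ : ℝ) (hδ : 0 < δ) (hη : 0 ≤ η) (hσ₀ : 0 < σ₀)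
    (ρ : Fin N → ℝ) (hρpos : ∀ i, 0 < ρ i) (hρsum : ∑ i, ρ i = 1)
    (σ b f : Fin N → ℝ → ℝ)
    (hσc : ∀ i, ContinuousOn (σ i) (Icc 0 δ)) (hbc : ∀ i, ContinuousOn (b i) (Icc 0 δ))
    (hfc : ∀ i, ContinuousOn (f i) (Icc 0 δ))
    (hσ : ∀ i, ∀ x ∈ Icc (0:ℝ) δ, σ₀ ≤ σ i x)
    (fv : ℝ) (hfv : ∀ i, f i 0 = fv)
    (u u' u'' : Fin N → ℝ → ℝ)
    (hsol : IsBVPSolAux N δ η fv ρ σ b f u u' u'') :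
    ∀ C : ℝ, (∀ i, ∀ x ∈ Icc (0:ℝ) δ, |u'' i x| ≤ C) →
      |u ⟨0, hN⟩ 0 + η * fv * δ| ≤ δ^2 / 2 * C := by
  obtain ⟨hu, hu', -, -, hv, hK, hend⟩ := hsol
  intro C hC
  have key : u ⟨0, hN⟩ 0 + η * fv * δ = ∑ i, ρ i * (u i 0 + u' i 0 * δ) := by
    have hsum : ∑ i, ρ i * u i 0 = u ⟨0, hN⟩ 0 := by
      simp_rw [fun i => hv i ⟨0, hN⟩]
      rw [← Finset.sum_mul, hρsum, one_mul]
    rw [hK, Finset.sum_mul, ← hsum, ← Finset.sum_add_distrib]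
    exact Finset.sum_congr rfl fun i _ => by ring
  have hedge : ∀ i, |u i 0 + u' i 0 * δ| ≤ δ ^ 2 / 2 * C := fun i => by
    have h := abs_taylor_one_le hδ (hu i) (hu' i) (hC i)
    rwa [hend i, ← abs_neg, show -(0 - u i 0 - u' i 0 * δ) = u i 0 + u' i 0 * δ by ring] at h
  calc |u ⟨0, hN⟩ 0 + η * fv * δ|
      ≤ ∑ i, |ρ i * (u i 0 + u' i 0 * δ)| := key ▸ Finset.abs_sum_le_sum_abs _ _
    _ ≤ ∑ i, ρ i * (δ ^ 2 / 2 * C) := Finset.sum_le_sum fun i _ => by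
        rw [abs_mul, abs_of_pos (hρpos i)]
        exact mul_le_mul_of_nonneg_left (hedge i) (hρpos i).le
    _ = δ ^ 2 / 2 * C := by rw [← Finset.sum_mul, hρsum, one_mul]
end

section
/- There exist δ₀ > 0 and C > 0, depending only on σ₀, η and B, such that for every 0 < δ ≤ δ₀ the unique solution u^δ = (u^δ₁,…,u^δ_N) of the boundary value problem on [0,δ] with right-hand side f_i ≡ −1 satisfies |u^δ₁(0) − ηδ| ≤ C δ². (This is the analytic content of the mean-first-passage-time asymptotics E_v[T_X^δ] = ηδ + O(δ²).) -/
open Set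

/-- `u = (u₁,…,u_N)`, together with first and second derivatives `u', u''` on `[0,δ]`,
is a (twice continuously differentiable) solution of the boundary value problem with
right-hand side `f_i ≡ −1`: `(1/2)σ_i² u_i'' + b_i u_i' = −1` on `(0,δ)`, continuity at the
vertex, `−η = ∑ ρ_i u_i'(0)`, and `u_i(δ) = 0`. -/
def IsBVPSolNegOne (N : ℕ) (δ η : ℝ) (ρ : Fin N → ℝ) (σ b : Fin N → ℝ → ℝ)
    (u u' u'' : Fin N → ℝ → ℝ) : Prop :=
  (∀ i, ∀ x ∈ Icc (0:ℝ) δ, HasDerivWithinAt (u i) (u' i x) (Icc (0:ℝ) δ) x) ∧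
  (∀ i, ∀ x ∈ Icc (0:ℝ) δ, HasDerivWithinAt (u' i) (u'' i x) (Icc (0:ℝ) δ) x) ∧
  (∀ i, ContinuousOn (u'' i) (Icc (0:ℝ) δ)) ∧
  (∀ i, ∀ x ∈ Ioo (0:ℝ) δ, (1/2) * (σ i x)^2 * u'' i x + b i x * u' i x = -1) ∧
  (∀ i j, u i 0 = u j 0) ∧
  (-η = ∑ i, ρ i * u' i 0) ∧
  (∀ i, u i δ = 0)

/-- If `p` solves `(1/2) σ² p' + b p = -1` on `(0,δ)` with `σ ≥ σ₀` and `|b| ≤ B`, then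
`|p'| ≤ K (1 + B M)` there, where `K = 2 / σ₀²` and `M` bounds `|p|`. -/
theorem abs_le_of_half_sq_mul_add_eq_neg_one {σ₀ B M s c p q : ℝ} (hσ₀ : 0 < σ₀)
    (hs : σ₀ ≤ s) (hc : |c| ≤ B) (hp : |p| ≤ M) (h : (1 / 2) * s ^ 2 * q + c * p = -1) :
    |q| ≤ 2 / σ₀ ^ 2 * (1 + B * M) := by
  have hcp : |c * p| ≤ B * M := by
    rw [abs_mul]
    exact mul_le_mul hc hp (abs_nonneg _) ((abs_nonneg _).trans hc)
  have hsq : σ₀ ^ 2 ≤ s ^ 2 := by gcongr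
  have hq : s ^ 2 * |q| = 2 * |1 + c * p| := by
    have h' : s ^ 2 * q = -(2 * (1 + c * p)) := by linarith
    rw [← abs_of_nonneg (sq_nonneg s), ← abs_mul, h', abs_neg, abs_mul, abs_two]
  have htri : |1 + c * p| ≤ 1 + B * M :=
    (abs_add_le _ _).trans (by rw [abs_one]; linarith)
  rw [div_mul_eq_mul_div, le_div_iff₀ (by positivity)]
  nlinarith [mul_le_mul_of_nonneg_right hsq (abs_nonneg q)]

/-- A solution of `(1/2) σ² u'' + b u' = -1` on a short interval `[0,δ]` with `u δ = 0` has initial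
slope close to the slope `-u 0 / δ` of its chord. -/
theorem abs_deriv_zero_add_div_le {σ₀ B δ : ℝ} (hσ₀ : 0 < σ₀) (hB : 0 < B) (hδ : 0 < δ)
    (hδB : δ * (2 / σ₀ ^ 2) * B ≤ 1 / 4) {σ b u u' u'' : ℝ → ℝ}
    (hσ : ∀ x ∈ Ici (0 : ℝ), σ₀ ≤ σ x) (hb : ∀ x ∈ Ici (0 : ℝ), |b x| ≤ B)
    (hu : ∀ x ∈ Icc 0 δ, HasDerivWithinAt u (u' x) (Icc 0 δ) x)
    (hu' : ∀ x ∈ Icc 0 δ, HasDerivWithinAt u' (u'' x) (Icc 0 δ) x)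
    (hu'' : ContinuousOn u'' (Icc 0 δ))
    (hode : ∀ x ∈ Ioo 0 δ, (1 / 2) * (σ x) ^ 2 * u'' x + b x * u' x = -1) (huδ : u δ = 0) :
    |u' 0 + u 0 / δ| ≤ 2 * (δ * (2 / σ₀ ^ 2)) * (1 + B * |u 0 / δ|) := by
  have h0 : (0 : ℝ) ∈ Icc 0 δ := ⟨le_rfl, hδ.le⟩
  have hcont : ContinuousOn u' (Icc 0 δ) := fun x hx => (hu' x hx).continuousWithinAt
  obtain ⟨y, hy, hmax⟩ := isCompact_Icc.exists_isMaxOn ⟨0, h0⟩ hcont.abs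
  have hM : ∀ x ∈ Icc 0 δ, |u' x| ≤ |u' y| := fun x hx => hmax hx
  set M := |u' y|
  set K := 2 / σ₀ ^ 2
  have hKpos : 0 < K := by positivity
  have hbound : ∀ x ∈ Icc 0 δ, |u'' x| ≤ K * (1 + B * M) := by
    have hcl : closure (Ioo 0 δ) = Icc 0 δ := closure_Ioo hδ.ne
    rw [← hcl]
    refine le_on_closure (fun x hx => ?_) (by rw [hcl]; exact hu''.abs) continuousOn_const
    exact abs_le_of_half_sq_mul_add_eq_neg_one hσ₀ (hσ x hx.1.le) (hb x hx.1.le)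
      (hM x (Ioo_subset_Icc_self hx)) (hode x hx)
  obtain ⟨ξ, hξ, hslope⟩ := exists_hasDerivAt_eq_slope u u' hδ
    (fun x hx => (hu x hx).continuousWithinAt)
    (fun x hx => (hu x (Ioo_subset_Icc_self hx)).hasDerivAt (Icc_mem_nhds hx.1 hx.2))
  rw [huδ, sub_zero, zero_sub, neg_div] at hslope
  have hξ' := Ioo_subset_Icc_self hξ
  have hM0 : 0 ≤ M := abs_nonneg _
  have hosc : ∀ x ∈ Icc 0 δ, |u' x + u 0 / δ| ≤ δ * K * (1 + B * M) := by
    intro x hx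
    have h := (convex_Icc (0 : ℝ) δ).norm_image_sub_le_of_norm_hasDerivWithin_le
      hu' hbound hξ' hx
    rw [hslope, sub_neg_eq_add, Real.norm_eq_abs, Real.norm_eq_abs] at h
    have hdist : |x - ξ| ≤ δ := by
      rw [abs_le]; constructor <;> linarith [hx.1, hx.2, hξ'.1, hξ'.2]
    calc _ ≤ K * (1 + B * M) * |x - ξ| := h
      _ ≤ K * (1 + B * M) * δ := by gcongr
      _ = _ := by ring
  have hMle : M ≤ δ * K * (1 + B * M) + |u 0 / δ| := by
    have h := abs_sub (u' y + u 0 / δ) (u 0 / δ)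
    rw [add_sub_cancel_right] at h
    linarith [hosc y hy]
  refine (hosc 0 h0).trans ?_
  have hδK : 0 < δ * K := by positivity
  have hBM : 1 + B * M ≤ 2 * (1 + B * |u 0 / δ|) := by
    nlinarith [mul_le_mul_of_nonneg_left hMle hB.le,
      mul_le_mul_of_nonneg_right hδB (show 0 ≤ 1 + B * M by positivity),
      mul_nonneg hB.le (abs_nonneg (u 0 / δ)), mul_nonneg hB.le hM0]
  nlinarith [mul_le_mul_of_nonneg_left hBM hδK.le]

/-- There exist `δ₀ > 0` and `C > 0`, depending only on `σ₀`, `η` and `B`,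
such that for every `0 < δ ≤ δ₀` the (unique) solution `u^δ` of the boundary value problem on
`[0,δ]` with right-hand side `f ≡ −1` satisfies `|u^δ₁(0) − ηδ| ≤ C δ²`. -/
theorem stmt_8 (σ₀ η B : ℝ) (hσ₀ : 0 < σ₀) (hη : 0 ≤ η) (hB : 0 < B) :
    ∃ δ₀ > (0:ℝ), ∃ C > (0:ℝ),
      ∀ (N : ℕ) (hN : 0 < N)
        (ρ : Fin N → ℝ), (∀ i, 0 < ρ i) → (∑ i, ρ i = 1) →
      ∀ σ b : Fin N → ℝ → ℝ,
        (∀ i, ContinuousOn (σ i) (Ici 0)) →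
        (∀ i, ContinuousOn (b i) (Ici 0)) →
        (∀ i, ∃ M, ∀ x ∈ Ici (0:ℝ), σ i x ≤ M) →
        (∀ i, ∀ x ∈ Ici (0:ℝ), σ₀ ≤ σ i x) →
        (∀ i, ∀ x ∈ Ici (0:ℝ), |b i x| ≤ B) →
      ∀ δ : ℝ, 0 < δ → δ ≤ δ₀ →
      ∀ u u' u'' : Fin N → ℝ → ℝ,
        IsBVPSolNegOne N δ η ρ σ b u u' u'' →
        |u ⟨0, hN⟩ 0 - η * δ| ≤ C * δ^2 := by
  set K := 2 / σ₀ ^ 2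
  have hKpos : 0 < K := by positivity
  refine ⟨1 / (4 * K * B), by positivity, 4 * K * (1 + B * η), by positivity, ?_⟩
  rintro N hN ρ hρ hρ1 σ b - - - hσ hb δ hδ hδ₀ u u' u'' ⟨hu, hu', hu'', hode, hvertex, hflux, huδ⟩
  have hδB : δ * K * B ≤ 1 / 4 := by
    rw [le_div_iff₀ (by positivity)] at hδ₀
    linarith
  set a := u ⟨0, hN⟩ 0 with ha
  have hslope : ∀ i, |u' i 0 + a / δ| ≤ 2 * (δ * K) * (1 + B * |a / δ|) := fun i => by
    rw [ha, ← hvertex i ⟨0, hN⟩]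
    exact abs_deriv_zero_add_div_le hσ₀ hB hδ hδB (hσ i) (hb i) (hu i) (hu' i) (hu'' i) (hode i)
      (huδ i)
  have havg : a / δ - η = ∑ i, ρ i * (u' i 0 + a / δ) := by
    simp only [mul_add, Finset.sum_add_distrib, ← Finset.sum_mul, ← hflux, hρ1]
    ring
  have hA : |a / δ - η| ≤ 2 * (δ * K) * (1 + B * |a / δ|) := by
    rw [havg]
    calc _ ≤ ∑ i, |ρ i * (u' i 0 + a / δ)| := Finset.abs_sum_le_sum_abs _ _
      _ ≤ ∑ i, ρ i * (2 * (δ * K) * (1 + B * |a / δ|)) := by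
        refine Finset.sum_le_sum fun i _ => ?_
        rw [abs_mul, abs_of_pos (hρ i)]
        exact mul_le_mul_of_nonneg_left (hslope i) (hρ i).le
      _ = _ := by rw [← Finset.sum_mul, hρ1, one_mul]
  have hδK : 0 < δ * K := by positivity
  have habs : |a / δ| ≤ |a / δ - η| + η := by
    have h := abs_add_le (a / δ - η) η
    rwa [sub_add_cancel, abs_of_nonneg hη] at h
  have hBA : 1 + B * |a / δ| ≤ 2 * (1 + B * η) := by
    nlinarith [mul_le_mul_of_nonneg_left (habs.trans (add_le_add_left hA η)) hB.le,
      mul_le_mul_of_nonneg_right hδB (show 0 ≤ 1 + B * |a / δ| by positivity)]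
  have hfinal : |a / δ - η| ≤ 4 * K * (1 + B * η) * δ := by
    nlinarith [mul_le_mul_of_nonneg_left hBA hδK.le]
  calc |a - η * δ| = |a / δ - η| * δ := by
        rw [← abs_of_pos hδ, ← abs_mul, abs_of_pos hδ, sub_mul, div_mul_cancel₀ _ hδ.ne']
    _ ≤ 4 * K * (1 + B * η) * δ * δ := by gcongr
    _ = 4 * K * (1 + B * η) * δ ^ 2 := by ring
end
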